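/- Let S be any ordering (stream) of the edges of a finite simple graph G with arboricity at most c, let μ > 2c be an integer, let h_μ be the number of vertices of degree greater than μ, let s_μ be the number of edges of G both of whose endpoints have degree at most μ, let α = max{μ − 1, 4c(μ+1)/(μ+1−2c)}, and let E_α be the set of α-good edges of S. Then (1/2 − c/(μ+1))·h_μ + s_μ ≤ |E_α|. -/

import Mathlib

open SimpleGraph

variable {V : Type*}

/-- `G` has arboricity at most `c`: its edge set can be partitioned into
at most `c` forests (equivalently, covered by `c` acyclic subgraphs). -/
def ArboricityLE (G : SimpleGraph V) (c : ℕ) : Prop :=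
  ∃ F : Fin c → SimpleGraph V,
    (∀ i, (F i).IsAcyclic) ∧ (∀ i, F i ≤ G) ∧
      ∀ ⦃v w : V⦄, G.Adj v w → ∃ i, (F i).Adj v w

/-- `M` is the size of a maximum matching of `G`. -/
def MaxMatchingSize {V : Type*} (G : SimpleGraph V) (M : ℕ) : Prop :=
  (∃ H : G.Subgraph, H.IsMatching ∧ H.edgeSet.ncard = M) ∧
    ∀ H : G.Subgraph, H.IsMatching → H.edgeSet.ncard ≤ M

/-- `l` is a stream (an ordering) of the edges of `G`. -/
def IsEdgeStream (G : SimpleGraph V) (l : List (Sym2 V)) : Prop :=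
  l.Nodup ∧ ∀ e, e ∈ l ↔ e ∈ G.edgeSet

/-- `dAfter l i x`: the number of edges appearing strictly after position `i`
in the stream `l` that are incident to `x`; for a stream of pairwise distinct
simple-graph edges this is the number of neighbors of `x` appearing (as the
other endpoint of an edge at `x`) strictly after position `i`. -/
noncomputable def dAfter (l : List (Sym2 V)) (i : ℕ) (x : V) : ℕ :=
  {j : Fin l.length | i < (j : ℕ) ∧ x ∈ l.get j}.ncard

/-- The edge at position `i` of the stream `l` is `α`-good. -/
def AlphaGood (l : List (Sym2 V)) (α : ℝ) (i : Fin l.length) : Prop :=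
  ∀ x ∈ l.get i, (dAfter l (i : ℕ) x : ℝ) ≤ α

/-- The number of `α`-good edges of the stream `l` (the size of `E_α`). -/
noncomputable def EalphaCard (l : List (Sym2 V)) (α : ℝ) : ℕ :=
  {i : Fin l.length | AlphaGood l α i}.ncard

theorem SimpleGraph.IsAcyclic.ncard_edgeSet_le [Finite V] {F : SimpleGraph V}
    (hF : F.IsAcyclic) : F.edgeSet.ncard ≤ Nat.card V := by
  classical
  have := Fintype.ofFinite V
  rcases isEmpty_or_nonempty V with h | h
  · simp [Set.eq_empty_of_isEmpty F.edgeSet]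
  · obtain ⟨T, hle, hT⟩ :=
      (connected_top (V := V)).exists_isTree_le_of_le_of_isAcyclic (le_top : F ≤ ⊤) hF
    have h1 := hT.2.card_edgeFinset
    have h2 : F.edgeSet.ncard ≤ T.edgeSet.ncard :=
      Set.ncard_le_ncard (edgeSet_mono hle) (Set.toFinite _)
    rw [← coe_edgeFinset T, Set.ncard_coe_finset] at h2
    rw [Nat.card_eq_fintype_card]
    omega

theorem SimpleGraph.IsAcyclic.ncard_edges_within_le [Finite V] {F : SimpleGraph V}
    (hF : F.IsAcyclic) (H : Set V) :
    {e ∈ F.edgeSet | ∀ x ∈ e, x ∈ H}.ncard ≤ H.ncard := by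
  have hsub : {e ∈ F.edgeSet | ∀ x ∈ e, x ∈ H} ⊆
      Sym2.map (Subtype.val : H → V) '' (F.induce H).edgeSet := by
    rintro ⟨u, v⟩ ⟨he, hx⟩
    exact ⟨s(⟨u, hx u (Sym2.mem_mk_left u v)⟩, ⟨v, hx v (Sym2.mem_mk_right u v)⟩), he, rfl⟩
  calc _ ≤ _ := Set.ncard_le_ncard hsub (Set.toFinite _)
    _ ≤ _ := Set.ncard_image_le (Set.toFinite _)
    _ ≤ _ := (hF.induce H).ncard_edgeSet_le
    _ = _ := Nat.card_coe_set_eq H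

theorem ArboricityLE.ncard_edges_within_le [Finite V] {G : SimpleGraph V} {c : ℕ}
    (h : ArboricityLE G c) (H : Set V) :
    {e ∈ G.edgeSet | ∀ x ∈ e, x ∈ H}.ncard ≤ c * H.ncard := by
  obtain ⟨F, hF, -, hcover⟩ := h
  have hsub : {e ∈ G.edgeSet | ∀ x ∈ e, x ∈ H} ⊆
      ⋃ i, {e ∈ (F i).edgeSet | ∀ x ∈ e, x ∈ H} := by
    rintro ⟨u, v⟩ ⟨he, hx⟩
    obtain ⟨i, hi⟩ := hcover he
    exact Set.mem_iUnion.2 ⟨i, hi, hx⟩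
  calc _ ≤ _ := Set.ncard_le_ncard hsub (Set.toFinite _)
    _ ≤ ∑ i, {e ∈ (F i).edgeSet | ∀ x ∈ e, x ∈ H}.ncard := Set.ncard_iUnion_le_of_fintype _
    _ ≤ ∑ _i : Fin c, H.ncard := Finset.sum_le_sum fun i _ => (hF i).ncard_edges_within_le H
    _ = _ := by simp

/-- At least `m` elements of a finite chain of size at least `m` have fewer than `m` elements
of the chain above them. -/
theorem Finset.le_card_filter_card_filter_lt {ι : Type*} [LinearOrder ι] (A : Finset ι) :
    ∀ m ≤ A.card, m ≤ (A.filter fun j => (A.filter fun k => j < k).card < m).card := by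
  induction A using Finset.induction_on_min with
  | empty => simp
  | insert a s ha ih =>
    intro m hm
    have hnot : a ∉ s := fun h => lt_irrefl _ (ha a h)
    rw [Finset.card_insert_of_notMem hnot] at hm
    have habove : ∀ j ∈ insert a s,
        (insert a s).filter (fun k => j < k) = s.filter (fun k => j < k) := by
      intro j hj
      rw [Finset.filter_insert, if_neg]
      rcases Finset.mem_insert.1 hj with rfl | hj
      · exact lt_irrefl _
      · exact (ha j hj).not_gt
    rcases hm.lt_or_eq with hlt | rfl
    · refine (ih m (Nat.lt_succ_iff.1 hlt)).trans (Finset.card_le_card fun j hj => ?_)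
      obtain ⟨hjs, hj⟩ := Finset.mem_filter.1 hj
      have hj' := Finset.mem_insert_of_mem (b := a) hjs
      exact Finset.mem_filter.2 ⟨hj', by rwa [habove j hj']⟩
    · rw [Finset.filter_true_of_mem, Finset.card_insert_of_notMem hnot]
      intro j hj
      rw [habove j hj]
      exact Nat.lt_succ_of_le (Finset.card_filter_le _ _)

/-- Counting the edges of a stream by position. -/
theorem IsEdgeStream.card_filter_get {G : SimpleGraph V} {l : List (Sym2 V)}
    (h : IsEdgeStream G l) (p : Sym2 V → Prop) [DecidablePred p] :
    (Finset.univ.filter fun i : Fin l.length => p (l.get i)).card =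
      {e ∈ G.edgeSet | p e}.ncard := by
  have himage : {e ∈ G.edgeSet | p e} = l.get '' {i | p (l.get i)} := by
    ext e
    simp only [Set.mem_ofPred_eq, Set.mem_image, ← h.2 e]
    constructor
    · rintro ⟨he, hp⟩
      obtain ⟨i, rfl⟩ := List.get_of_mem he
      exact ⟨i, hp, rfl⟩
    · rintro ⟨i, hp, rfl⟩
      exact ⟨List.get_mem l i, hp⟩
  rw [himage, Set.ncard_image_of_injective _ (List.nodup_iff_injective_get.1 h.1),
    ← Set.ncard_coe_finset]
  simp

theorem dAfter_eq_card_filter [DecidableEq V] (l : List (Sym2 V)) (i : Fin l.length) (x : V) :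
    dAfter l i x =
      ((Finset.univ.filter fun j => x ∈ l.get j).filter fun j => i < j).card := by
  rw [dAfter, ← Set.ncard_coe_finset]
  congr 1
  ext j
  simp [and_comm]

theorem IsEdgeStream.card_positions_eq_degree [Fintype V] [DecidableEq V] {G : SimpleGraph V}
    [DecidableRel G.Adj] {l : List (Sym2 V)} (h : IsEdgeStream G l) (x : V) :
    (Finset.univ.filter fun j : Fin l.length => x ∈ l.get j).card = G.degree x := by
  rw [h.card_filter_get (x ∈ ·), ← G.card_incidenceFinset_eq_degree x, ← Set.ncard_coe_finset,
    coe_incidenceFinset]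
  rfl

theorem IsEdgeStream.dAfter_lt_degree [Fintype V] {G : SimpleGraph V}
    [DecidableRel G.Adj] {l : List (Sym2 V)} (h : IsEdgeStream G l) {i : Fin l.length} {x : V}
    (hx : x ∈ l.get i) : dAfter l i x < G.degree x := by
  classical
  rw [← h.card_positions_eq_degree x, dAfter_eq_card_filter]
  refine Finset.card_lt_card (Finset.filter_ssubset.2 ⟨i, ?_, lt_irrefl _⟩)
  simpa using hx

theorem IsEdgeStream.le_card_late_positions [Fintype V] [DecidableEq V] {G : SimpleGraph V}
    [DecidableRel G.Adj] {l : List (Sym2 V)} (h : IsEdgeStream G l) {m : ℕ} {x : V}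
    (hm : m ≤ G.degree x) :
    m ≤ (Finset.univ.filter fun i : Fin l.length => x ∈ l.get i ∧ dAfter l i x < m).card := by
  rw [← h.card_positions_eq_degree x] at hm
  simpa only [dAfter_eq_card_filter, Finset.filter_filter] using
    Finset.le_card_filter_card_filter_lt _ m hm

/-- Integral form of the bound: the last `μ` edges at each vertex of degree above `μ` suffice. -/
theorem IsEdgeStream.mul_card_heavy_add_card_light_le [Fintype V] {G : SimpleGraph V}
    [DecidableRel G.Adj] {l : List (Sym2 V)} {c μ : ℕ} (h : IsEdgeStream G l)
    (harb : ArboricityLE G c) :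
    μ * {v : V | μ < G.degree v}.ncard +
        {e ∈ G.edgeSet | ∀ x ∈ e, G.degree x ≤ μ}.ncard ≤
      c * {v : V | μ < G.degree v}.ncard +
        {i : Fin l.length | ∀ x ∈ l.get i, dAfter l i x < μ}.ncard := by
  classical
  set H : Finset V := Finset.univ.filter fun v => μ < G.degree v with hH
  have hHset : {v : V | μ < G.degree v} = H := by ext; simp [hH]
  have hwithin := harb.ncard_edges_within_le {v : V | μ < G.degree v}
  rw [hHset, Set.ncard_coe_finset, ← hHset, ← h.card_filter_get] at hwithin
  rw [hHset, Set.ncard_coe_finset, ← h.card_filter_get]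
  have hgood : {i : Fin l.length | ∀ x ∈ l.get i, dAfter l i x < μ} =
      (Finset.univ.filter fun i : Fin l.length => ∀ x ∈ l.get i, dAfter l i x < μ) := by
    ext; simp
  rw [hgood, Set.ncard_coe_finset]
  have hlate : μ * H.card ≤ ∑ v ∈ H,
      (Finset.univ.filter fun i : Fin l.length => v ∈ l.get i ∧ dAfter l i v < μ).card := by
    rw [mul_comm, ← smul_eq_mul]
    exact Finset.card_nsmul_le_sum _ _ _ fun v hv =>
      h.le_card_late_positions (Finset.mem_filter.1 hv).2.le
  refine (Nat.add_le_add_right hlate _).trans (le_trans ?_ (Nat.add_le_add_right hwithin _))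
  simp only [Finset.card_filter]
  rw [Finset.sum_comm, ← Finset.sum_add_distrib, ← Finset.sum_add_distrib]
  refine Finset.sum_le_sum fun i _ => ?_
  have hdeg : ∀ x ∈ l.get i, dAfter l i x < G.degree x := fun x hx => h.dAfter_lt_degree hx
  have hedge : l.get i ∈ G.edgeSet := (h.2 _).1 (List.get_mem l i)
  rw [← Finset.card_filter]
  generalize l.get i = e at hdeg hedge ⊢
  induction e with
  | h u v =>
    have huv : u ≠ v := G.ne_of_adj hedge
    have hu := hdeg u (Sym2.mem_mk_left u v)
    have hv := hdeg v (Sym2.mem_mk_right u v)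
    have hfilter : (H.filter fun x => x ∈ s(u, v) ∧ dAfter l i x < μ) =
        (({u, v} : Finset V).filter fun x => μ < G.degree x ∧ dAfter l i x < μ) := by
      ext x
      simp only [hH, Finset.mem_filter, Finset.mem_univ, true_and, Sym2.mem_iff,
        Finset.mem_insert, Finset.mem_singleton]
      tauto
    rw [hfilter, Finset.card_filter, Finset.sum_pair huv]
    simp only [Sym2.mem_iff, forall_eq_or_imp, forall_eq, Set.mem_ofPred_eq]
    split_ifs <;> grind

theorem statement_6 {V : Type*} [Fintype V] (G : SimpleGraph V) [DecidableRel G.Adj]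
    (c μ : ℕ) (l : List (Sym2 V)) (hstream : IsEdgeStream G l)
    (harb : ArboricityLE G c) (hμ : 2 * c < μ) :
    (1 / 2 - (c : ℝ) / (μ + 1)) * ({v : V | μ < G.degree v}.ncard : ℝ) +
        ({e ∈ G.edgeSet | ∀ x ∈ e, G.degree x ≤ μ}.ncard : ℝ) ≤
      (EalphaCard l (max ((μ : ℝ) - 1) (4 * c * (μ + 1) / (μ + 1 - 2 * c))) : ℝ) := by
  have hmain := hstream.mul_card_heavy_add_card_light_le (μ := μ) harb
  have hgood : {i : Fin l.length | ∀ x ∈ l.get i, dAfter l i x < μ}.ncard ≤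
      EalphaCard l (max ((μ : ℝ) - 1) (4 * c * (μ + 1) / (μ + 1 - 2 * c))) := by
    refine Set.ncard_le_ncard (fun i hi x hx => le_max_of_le_left ?_) (Set.toFinite _)
    have hlt : ((dAfter l i x + 1 : ℕ) : ℝ) ≤ μ := by exact_mod_cast hi x hx
    push_cast at hlt
    linarith
  have hgap : (c : ℝ) + 1 ≤ μ := by exact_mod_cast (show c + 1 ≤ μ by omega)
  have hfrac : 0 ≤ (c : ℝ) / (μ + 1) := by positivity
  have hcoef : 1 / 2 - (c : ℝ) / (μ + 1) ≤ μ - c := by linarith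
  have hle := mul_le_mul_of_nonneg_right hcoef
    (Nat.cast_nonneg (α := ℝ) {v : V | μ < G.degree v}.ncard)
  have hmain' := hmain.trans (Nat.add_le_add_left hgood _)
  replace hmain' := (Nat.cast_le (α := ℝ)).2 hmain'
  simp only [Nat.cast_add, Nat.cast_mul] at hmain'
  linarith
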